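/- arXiv:1512.07267 — 2 statements merged into one kernel-verified Lean document; each statement's English description precedes it below -/
import Mathlib

section
/- Suppose all k groups are interior (n_j ≥ 2 and 1 ≤ y_j ≤ n_j − 1 for all j), let u > 0, let g be a probability density on ℝ^m, and suppose k ≥ u + 1. Then ∫_{ℝ^m} ∫_0^∞ r^{−(u+1)} · g(β) · L(r, β) dr dβ < ∞. -/
open MeasureTheory Real Filter Finset

/-- The Beta function `B(a,b) = ∫₀¹ v^(a-1) (1-v)^(b-1) dv`. -/
noncomputable def betaFn (a b : ℝ) : ℝ :=
  ∫ v in (0:ℝ)..1, v ^ (a - 1) * (1 - v) ^ (b - 1)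

/-- The standard logistic function `σ(t) = exp t / (1 + exp t)`. -/
noncomputable def logistic (t : ℝ) : ℝ := Real.exp t / (1 + Real.exp t)

/-- Expected random effect `p_j^E(β) = σ(x_jᵀ β)`. -/
noncomputable def pE {k m : ℕ} (x : Fin k → Fin m → ℝ) (j : Fin k) (β : Fin m → ℝ) : ℝ :=
  logistic (∑ i, x j i * β i)

/-- The Beta-Binomial likelihood
`L(r,β) = ∏ⱼ C(nⱼ,yⱼ) B(yⱼ + r pⱼᴱ, nⱼ - yⱼ + r qⱼᴱ) / B(r pⱼᴱ, r qⱼᴱ)`. -/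
noncomputable def bbL {k m : ℕ} (x : Fin k → Fin m → ℝ) (n y : Fin k → ℕ)
    (r : ℝ) (β : Fin m → ℝ) : ℝ :=
  ∏ j : Fin k,
    ((n j).choose (y j) : ℝ) *
      betaFn ((y j : ℝ) + r * pE x j β) (((n j : ℝ) - (y j : ℝ)) + r * (1 - pE x j β)) /
      betaFn (r * pE x j β) (r * (1 - pE x j β))

theorem logistic_pos (t : ℝ) : 0 < logistic t := by
  unfold logistic
  positivity

theorem logistic_lt_one (t : ℝ) : logistic t < 1 := by
  unfold logistic
  rw [div_lt_one (by positivity)]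
  linarith

theorem ofReal_betaIntegrand {a b v : ℝ} (hv : v ∈ Set.Icc (0:ℝ) 1) :
    ((v ^ (a - 1) * (1 - v) ^ (b - 1) : ℝ) : ℂ) =
      (v : ℂ) ^ ((a : ℂ) - 1) * (1 - (v : ℂ)) ^ ((b : ℂ) - 1) := by
  rw [Complex.ofReal_mul, Complex.ofReal_cpow hv.1, Complex.ofReal_cpow (sub_nonneg.2 hv.2)]
  push_cast
  rfl

theorem betaFn_eq_beta {a b : ℝ} (ha : 0 < a) (hb : 0 < b) :
    betaFn a b = ProbabilityTheory.beta a b := by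
  rw [ProbabilityTheory.beta_eq_betaIntegralReal a b ha hb, betaFn, Complex.betaIntegral]
  have h : ∫ v in (0:ℝ)..1, (v : ℂ) ^ ((a : ℂ) - 1) * (1 - (v : ℂ)) ^ ((b : ℂ) - 1) =
      ∫ v in (0:ℝ)..1, ((v ^ (a - 1) * (1 - v) ^ (b - 1) : ℝ) : ℂ) := by
    refine intervalIntegral.integral_congr fun v hv => ?_
    rw [Set.uIcc_of_le zero_le_one] at hv
    exact (ofReal_betaIntegrand hv).symm
  rw [h, intervalIntegral.integral_ofReal, Complex.ofReal_re]

theorem betaFn_pos {a b : ℝ} (ha : 0 < a) (hb : 0 < b) : 0 < betaFn a b :=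
  betaFn_eq_beta ha hb ▸ ProbabilityTheory.beta_pos ha hb

theorem intervalIntegrable_betaFn {a b : ℝ} (ha : 0 < a) (hb : 0 < b) :
    IntervalIntegrable (fun v : ℝ => v ^ (a - 1) * (1 - v) ^ (b - 1)) volume 0 1 := by
  have h := Complex.betaIntegral_convergent (u := (a : ℂ)) (v := (b : ℂ)) (by simpa) (by simpa)
  rw [intervalIntegrable_iff_integrableOn_Ioc_of_le zero_le_one] at h ⊢
  have h' := h.re
  refine IntegrableOn.congr_fun h' (fun v hv => ?_) measurableSet_Ioc
  rw [← ofReal_betaIntegrand (Set.Ioc_subset_Icc_self hv)]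
  simp

theorem betaFn_anti {a b a' b' : ℝ} (ha : 0 < a) (hb : 0 < b) (haa : a ≤ a') (hbb : b ≤ b') :
    betaFn a' b' ≤ betaFn a b := by
  refine intervalIntegral.integral_mono_on_of_le_Ioo zero_le_one
    (intervalIntegrable_betaFn (ha.trans_le haa) (hb.trans_le hbb))
    (intervalIntegrable_betaFn ha hb) fun v hv => ?_
  have h0 : 0 < v := hv.1
  have h1 : 0 < 1 - v := sub_pos.2 hv.2
  exact mul_le_mul
    (rpow_le_rpow_of_exponent_ge h0 hv.2.le (by linarith))
    (rpow_le_rpow_of_exponent_ge h1 (by linarith) (by linarith))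
    (by positivity) (by positivity)

theorem betaFn_add_one_add_one {a b : ℝ} (ha : 0 < a) (hb : 0 < b) :
    betaFn (a + 1) (b + 1) = a * b / ((a + b) * (a + b + 1)) * betaFn a b := by
  rw [betaFn_eq_beta ha hb, betaFn_eq_beta (by linarith) (by linarith)]
  unfold ProbabilityTheory.beta
  have hG := (Gamma_pos_of_pos (add_pos ha hb)).ne'
  rw [show a + 1 + (b + 1) = (a + b + 1) + 1 by ring, Gamma_add_one ha.ne', Gamma_add_one hb.ne',
    Gamma_add_one (s := a + b + 1) (by positivity), Gamma_add_one (s := a + b) (by positivity)]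
  field_simp

theorem betaFn_div_betaFn_le {s t a b : ℝ} (hs : 1 ≤ s) (ht : 1 ≤ t) (ha : 0 < a) (hb : 0 < b) :
    betaFn (s + a) (t + b) / betaFn a b ≤ min 1 (a + b) := by
  have h : betaFn (s + a) (t + b) / betaFn a b ≤ a * b / ((a + b) * (a + b + 1)) := by
    rw [div_le_iff₀ (betaFn_pos ha hb), ← betaFn_add_one_add_one ha hb]
    exact betaFn_anti (by linarith) (by linarith) (by linarith) (by linarith)
  refine h.trans (le_min ?_ ?_)
  · rw [div_le_one (by positivity)]
    nlinarith [mul_pos ha hb, sq_nonneg a, sq_nonneg b]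
  · rw [div_le_iff₀ (by positivity)]
    have hab := mul_pos ha hb
    have hsq : a * b ≤ (a + b) ^ 2 := by nlinarith [sq_nonneg a, sq_nonneg b]
    have hcu : 0 ≤ (a + b) ^ 3 := by positivity
    nlinarith

/-- The marginal likelihood of interior groups is bounded, uniformly in `β`, by a multiple of
`min 1 r ^ k`. -/
theorem bbL_le {k m : ℕ} (x : Fin k → Fin m → ℝ) {n y : Fin k → ℕ}
    (hint : ∀ j, 2 ≤ n j ∧ 1 ≤ y j ∧ y j ≤ n j - 1) {r : ℝ} (hr : 0 < r) (β : Fin m → ℝ) :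
    bbL x n y r β ≤ (∏ j, ((n j).choose (y j) : ℝ)) * min 1 r ^ k := by
  have hprod : (∏ j, ((n j).choose (y j) : ℝ)) * min 1 r ^ k =
      ∏ j : Fin k, ((n j).choose (y j) : ℝ) * min 1 r := by
    rw [prod_mul_distrib, prod_const, card_univ, Fintype.card_fin]
  rw [hprod, bbL]
  have key : ∀ j, 0 < r * pE x j β ∧ 0 < r * (1 - pE x j β) ∧ (1:ℝ) ≤ y j ∧
      (1:ℝ) ≤ (n j : ℝ) - y j := fun j => by
    obtain ⟨h2, hy, hyn⟩ := hint j
    refine ⟨mul_pos hr (logistic_pos _), mul_pos hr (sub_pos.2 (logistic_lt_one _)),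
      by exact_mod_cast hy, ?_⟩
    have h : ((y j + 1 : ℕ) : ℝ) ≤ n j := by exact_mod_cast (by omega : y j + 1 ≤ n j)
    push_cast at h
    linarith
  refine prod_le_prod (fun j _ => ?_) fun j _ => ?_ <;> obtain ⟨ha, hb, hs, ht⟩ := key j
  · exact div_nonneg (mul_nonneg (Nat.cast_nonneg _)
      (betaFn_pos (by linarith) (by linarith)).le) (betaFn_pos ha hb).le
  · rw [mul_div_assoc]
    refine mul_le_mul_of_nonneg_left ?_ (Nat.cast_nonneg _)
    have h := betaFn_div_betaFn_le hs ht ha hb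
    rwa [← mul_add, add_sub_cancel, mul_one] at h

theorem lintegral_rpow_neg_mul_min_pow_lt_top {u : ℝ} (hu : 0 < u) {k : ℕ}
    (hk : u + 1 ≤ (k : ℝ)) :
    ∫⁻ r in Set.Ioi (0:ℝ), ENNReal.ofReal (r ^ (-(u + 1)) * min 1 r ^ k) < ⊤ := by
  rw [← Set.Ioc_union_Ioi_eq_Ioi (zero_le_one' ℝ)]
  refine (lintegral_union_le _ _ _).trans_lt (ENNReal.add_lt_top.2 ⟨?_, ?_⟩)
  · refine (setLIntegral_mono (g := fun _ => 1) measurable_const fun r hr => ?_).trans_lt (by simp)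
    rw [ENNReal.ofReal_le_one, min_eq_right hr.2, ← rpow_natCast, ← rpow_add hr.1]
    exact rpow_le_one hr.1.le hr.2 (by linarith)
  · have hint := integrableOn_Ioi_rpow_of_lt (a := -(u + 1)) (by linarith) zero_lt_one
    refine lt_of_le_of_lt (setLIntegral_mono' measurableSet_Ioi fun r hr => ?_)
      hint.lintegral_lt_top
    rw [min_eq_left (le_of_lt hr), one_pow, mul_one]

/-- Theorem 2 (sufficiency): all groups interior, improper hyper-prior `dr/r^{u+1}` on `r`,
proper hyper-prior density `g` on `β`, and `k ≥ u + 1`. Then the posterior is proper. -/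
theorem posterior_proper_improper_r_proper_beta (k m : ℕ) (x : Fin k → Fin m → ℝ)
    (n y : Fin k → ℕ) (hint : ∀ j, 2 ≤ n j ∧ 1 ≤ y j ∧ y j ≤ n j - 1)
    (u : ℝ) (hu : 0 < u) (hk : u + 1 ≤ (k : ℝ))
    (g : (Fin m → ℝ) → ℝ) (hgm : Measurable g) (hg0 : ∀ β, 0 ≤ g β)
    (hg1 : ∫⁻ β : Fin m → ℝ, ENNReal.ofReal (g β) = 1) :
    (∫⁻ β : Fin m → ℝ, ∫⁻ r in Set.Ioi (0:ℝ),
        ENNReal.ofReal (r ^ (-(u + 1)) * g β * bbL x n y r β)) < ⊤ := by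
  set K : ℝ := ∏ j, ((n j).choose (y j) : ℝ)
  have hK : 0 ≤ K := prod_nonneg fun _ _ => Nat.cast_nonneg _
  set M := ∫⁻ r in Set.Ioi (0:ℝ), ENNReal.ofReal (r ^ (-(u + 1)) * min 1 r ^ k)
  have hM : M < ⊤ := lintegral_rpow_neg_mul_min_pow_lt_top hu hk
  have hinner : ∀ β, ∫⁻ r in Set.Ioi (0:ℝ),
      ENNReal.ofReal (r ^ (-(u + 1)) * g β * bbL x n y r β) ≤
        ENNReal.ofReal (g β) * (ENNReal.ofReal K * M) := fun β => by
    rw [← mul_assoc, ← ENNReal.ofReal_mul (hg0 β),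
      ← lintegral_const_mul' _ _ ENNReal.ofReal_ne_top]
    refine setLIntegral_mono' measurableSet_Ioi fun r hr => ?_
    have hr0 : 0 < r := hr
    rw [← ENNReal.ofReal_mul (mul_nonneg (hg0 β) hK)]
    refine ENNReal.ofReal_le_ofReal ?_
    calc r ^ (-(u + 1)) * g β * bbL x n y r β
        ≤ r ^ (-(u + 1)) * g β * (K * min 1 r ^ k) :=
          mul_le_mul_of_nonneg_left (bbL_le x hint hr0 β)
            (mul_nonneg (rpow_nonneg hr0.le _) (hg0 β))
      _ = g β * K * (r ^ (-(u + 1)) * min 1 r ^ k) := by ring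
  refine (lintegral_mono hinner).trans_lt ?_
  rw [lintegral_mul_const _ hgm.ennreal_ofReal, hg1, one_mul]
  exact ENNReal.mul_lt_top ENNReal.ofReal_lt_top hM
end

section
/- Suppose the data contain at least one interior group and at least one extreme group, i.e., 1 ≤ k_y ≤ k−1, where W_y = {j : 1 ≤ y_j ≤ n_j − 1} and k_y = |W_y|. Then there exist constants c, c' > 0 depending only on the data such that for all r > 0 and β ∈ ℝ^m: c' · [r^{k_y} · ∏_{j∈W_y} p_j^E(β) q_j^E(β) / (1+r)^{Σ_{j∈W_y}(n_j−1)}] · ∏_{j∉W_y} (p_j^E(β))^{n_j·1{y_j = n_j}} (q_j^E(β))^{n_j·1{y_j = 0}} ≤ L(r, β) ≤ c · r^{k_y} · ∏_{j∈W_y} p_j^E(β) q_j^E(β) / (1+r)^{k_y}. -/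
open MeasureTheory Real Filter Finset

theorem Gamma_add_natCast {a : ℝ} (ha : 0 < a) (n : ℕ) :
    Real.Gamma (a + n) = (∏ i ∈ range n, (a + i)) * Real.Gamma a := by
  induction n with
  | zero => simp
  | succ n ih =>
    have h : a + n ≠ 0 := by positivity
    rw [prod_range_succ, Nat.cast_succ, ← add_assoc, Real.Gamma_add_one h, ih]
    ring

theorem betaFn_eq_Gamma_div {a b : ℝ} (ha : 0 < a) (hb : 0 < b) :
    betaFn a b = Real.Gamma a * Real.Gamma b / Real.Gamma (a + b) := by
  have hcast : ((betaFn a b : ℝ) : ℂ) = Complex.betaIntegral a b := by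
    rw [betaFn, Complex.betaIntegral, ← intervalIntegral.integral_ofReal]
    refine intervalIntegral.integral_congr fun v hv => ?_
    rw [Set.uIcc_of_le zero_le_one] at hv
    have h1 : 0 ≤ 1 - v := by linarith [hv.2]
    simp only [Complex.ofReal_mul, Complex.ofReal_cpow hv.1, Complex.ofReal_cpow h1]
    push_cast
    rfl
  have hbeta := ProbabilityTheory.beta_eq_betaIntegralReal a b ha hb
  rw [← hcast, Complex.ofReal_re] at hbeta
  rw [← hbeta, ProbabilityTheory.beta]

/-- The Beta-Binomial ratio of Beta functions as a ratio of rising factorials. -/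
theorem betaFn_add_div_betaFn {a b : ℝ} (ha : 0 < a) (hb : 0 < b) (s t : ℕ) :
    betaFn (s + a) (t + b) / betaFn a b =
      (∏ i ∈ range s, (a + i)) * (∏ i ∈ range t, (b + i)) /
        ∏ i ∈ range (s + t), (a + b + i) := by
  have hs : (s : ℝ) + a + (t + b) = a + b + ((s + t : ℕ) : ℝ) := by push_cast; ring
  rw [betaFn_eq_Gamma_div ha hb, betaFn_eq_Gamma_div (by positivity) (by positivity), hs,
    add_comm (s : ℝ), add_comm (t : ℝ), Gamma_add_natCast ha, Gamma_add_natCast hb,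
    Gamma_add_natCast (add_pos ha hb)]
  have h1 := (Real.Gamma_pos_of_pos ha).ne'
  have h2 := (Real.Gamma_pos_of_pos hb).ne'
  have h3 := (Real.Gamma_pos_of_pos (add_pos ha hb)).ne'
  have h4 : ∏ i ∈ range (s + t), (a + b + (i : ℝ)) ≠ 0 :=
    prod_ne_zero_iff.2 fun i _ => by positivity
  field_simp

/-- Rising factorials started at `1` are at least `1`. -/
theorem one_le_prod_add_natCast_add_one {a : ℝ} (ha : 0 ≤ a) (n : ℕ) :
    1 ≤ ∏ i ∈ range n, (a + (i + 1 : ℕ)) :=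
  Eq.trans_le (by simp) (prod_le_prod (s := range n) (f := fun _ => (1 : ℝ))
    (fun _ _ => zero_le_one) fun i _ => by
      push_cast; linarith [(Nat.cast_nonneg i : (0 : ℝ) ≤ i)])

theorem prod_add_natCast_add_one_le {a r : ℝ} (ha : 0 ≤ a) (har : a ≤ r) {n N : ℕ} (h : n ≤ N) :
    ∏ i ∈ range n, (a + (i + 1 : ℕ)) ≤ ((N : ℝ) * (1 + r)) ^ n := by
  refine (prod_le_prod (fun i _ => by positivity)
    (g := fun _ => (N : ℝ) * (1 + r)) fun i hi => ?_).trans_eq (by simp)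
  have hi' : ((i + 1 : ℕ) : ℝ) ≤ N := by
    exact_mod_cast (Nat.succ_le_of_lt (mem_range.1 hi)).trans h
  have h1 : (1 : ℝ) ≤ N := le_trans (by push_cast; linarith [(Nat.cast_nonneg i : (0 : ℝ) ≤ i)]) hi'
  nlinarith

theorem one_add_pow_le_prod_add_natCast_add_one {r : ℝ} (hr : 0 ≤ r) (n : ℕ) :
    (1 + r) ^ n ≤ ∏ i ∈ range n, (r + (i + 1 : ℕ)) := by
  refine Eq.trans_le (by simp) (prod_le_prod (s := range n) (f := fun _ => 1 + r)
    (fun i _ => by positivity) fun i hi => ?_)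
  push_cast
  linarith [(Nat.cast_nonneg i : (0 : ℝ) ≤ i)]

/-- For positive counts, the ratio of rising factorials is squeezed between multiples of
`r p q / (1 + r) ^ (s + t - 1)` and `r p q / (1 + r)`. -/
theorem interior_ratio_bounds (s t : ℕ) {r p q : ℝ} (hr : 0 < r) (hp : 0 < p)
    (hq : 0 < q) (hpq : p + q = 1) :
    (((s + t + 1 : ℕ) : ℝ) ^ (s + t + 1))⁻¹ * (r * (p * q) / (1 + r) ^ (s + t + 1)) ≤
        (∏ i ∈ range (s + 1), (r * p + i)) * (∏ i ∈ range (t + 1), (r * q + i)) /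
          ∏ i ∈ range (s + 1 + (t + 1)), (r + i) ∧
      (∏ i ∈ range (s + 1), (r * p + i)) * (∏ i ∈ range (t + 1), (r * q + i)) /
          ∏ i ∈ range (s + 1 + (t + 1)), (r + i) ≤
        ((s + t + 1 : ℕ) : ℝ) ^ (s + t) * (r * (p * q) / (1 + r)) := by
  have hp0 : 0 ≤ r * p := by positivity
  have hq0 : 0 ≤ r * q := by positivity
  have hpr : r * p ≤ r := by nlinarith
  have hqr : r * q ≤ r := by nlinarith
  have hst : s + 1 + (t + 1) = s + t + 1 + 1 := by ring
  rw [hst, prod_range_succ' _ s, prod_range_succ' _ t, prod_range_succ' _ (s + t + 1)]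
  have hA1 := one_le_prod_add_natCast_add_one hp0 s
  have hB1 := one_le_prod_add_natCast_add_one hq0 t
  have hA2 := prod_add_natCast_add_one_le hp0 hpr (show s ≤ s + t + 1 by omega)
  have hB2 := prod_add_natCast_add_one_le hq0 hqr (show t ≤ s + t + 1 by omega)
  have hD1 := one_add_pow_le_prod_add_natCast_add_one hr.le (s + t + 1)
  have hD2 := prod_add_natCast_add_one_le hr.le le_rfl (le_refl (s + t + 1))
  set A := ∏ i ∈ range s, (r * p + (i + 1 : ℕ))
  set B := ∏ i ∈ range t, (r * q + (i + 1 : ℕ))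
  set D := ∏ i ∈ range (s + t + 1), (r + (i + 1 : ℕ))
  set N : ℝ := ((s + t + 1 : ℕ) : ℝ)
  have hN : 0 < N := by positivity
  have hD : 0 < D := lt_of_lt_of_le (by positivity) hD1
  have hAB1 : 1 ≤ A * B := one_le_mul_of_one_le_of_one_le hA1 hB1
  have hAB2 : A * B ≤ (N * (1 + r)) ^ (s + t) := by
    rw [pow_add]
    exact mul_le_mul hA2 hB2 (by linarith) (by positivity)
  have key : A * (r * p + (0 : ℕ)) * (B * (r * q + (0 : ℕ))) / (D * (r + (0 : ℕ))) =
      r * (p * q) * (A * B / D) := by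
    push_cast
    field_simp
    ring
  rw [key]
  constructor
  · calc (N ^ (s + t + 1))⁻¹ * (r * (p * q) / (1 + r) ^ (s + t + 1))
        = r * (p * q) * (1 / (N * (1 + r)) ^ (s + t + 1)) := by
          rw [mul_pow]; field_simp
      _ ≤ r * (p * q) * (A * B / D) := by gcongr
  · calc r * (p * q) * (A * B / D)
        ≤ r * (p * q) * ((N * (1 + r)) ^ (s + t) / (1 + r) ^ (s + t + 1)) := by gcongr
      _ = N ^ (s + t) * (r * (p * q) / (1 + r)) := by
          rw [mul_pow, pow_succ (1 + r)]; field_simp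

theorem extreme_ratio_bounds (n : ℕ) {r p : ℝ} (hr : 0 < r) (hp : 0 < p) (hp1 : p ≤ 1) :
    p ^ n ≤ (∏ i ∈ range n, (r * p + i)) / ∏ i ∈ range n, (r + i) ∧
      (∏ i ∈ range n, (r * p + i)) / ∏ i ∈ range n, (r + (i : ℝ)) ≤ 1 := by
  have hD : 0 < ∏ i ∈ range n, (r + (i : ℝ)) := prod_pos fun i _ => by positivity
  rw [le_div_iff₀ hD, div_le_one hD]
  constructor
  · rw [← card_range n, ← prod_const, card_range, ← prod_mul_distrib]
    refine prod_le_prod (fun i _ => by positivity) fun i _ => ?_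
    nlinarith [(Nat.cast_nonneg i : (0 : ℝ) ≤ i)]
  · refine prod_le_prod (fun i _ => by positivity) fun i _ => ?_
    nlinarith

/-- A single Beta-Binomial factor, in terms of the mean `p` and precision `r`. -/
noncomputable def bbFactor (n y : ℕ) (r p : ℝ) : ℝ :=
  (n.choose y : ℝ) * betaFn (y + r * p) (((n : ℝ) - y) + r * (1 - p)) /
    betaFn (r * p) (r * (1 - p))

theorem bbFactor_eq {n y : ℕ} (hy : y ≤ n) {r p : ℝ} (hr : 0 < r) (hp : 0 < p) (hp1 : p < 1) :
    bbFactor n y r p = (n.choose y : ℝ) *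
      ((∏ i ∈ range y, (r * p + i)) * (∏ i ∈ range (n - y), (r * (1 - p) + i)) /
        ∏ i ∈ range n, (r + i)) := by
  have hq : 0 < 1 - p := by linarith
  have h := betaFn_add_div_betaFn (mul_pos hr hp) (mul_pos hr hq) y (n - y)
  rw [Nat.cast_sub hy, Nat.add_sub_cancel' hy, show r * p + r * (1 - p) = r by ring] at h
  rw [bbFactor, mul_div_assoc, h]

theorem exists_bbFactor_interior_bounds {n y : ℕ} (hy1 : 1 ≤ y) (hyn : y ≤ n - 1) :
    ∃ c c' : ℝ, 0 < c ∧ 0 < c' ∧ ∀ r p : ℝ, 0 < r → 0 < p → p < 1 →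
      c' * (r * (p * (1 - p)) / (1 + r) ^ (n - 1)) ≤ bbFactor n y r p ∧
        bbFactor n y r p ≤ c * (r * (p * (1 - p)) / (1 + r)) := by
  obtain ⟨s, rfl⟩ : ∃ s, y = s + 1 := ⟨y - 1, by omega⟩
  obtain ⟨t, rfl⟩ : ∃ t, n = s + 1 + (t + 1) := ⟨n - s - 2, by omega⟩
  have hC : 0 < ((s + 1 + (t + 1)).choose (s + 1) : ℝ) := by
    exact_mod_cast Nat.choose_pos (by omega)
  refine ⟨((s + 1 + (t + 1)).choose (s + 1) : ℝ) * ((s + t + 1 : ℕ) : ℝ) ^ (s + t),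
    ((s + 1 + (t + 1)).choose (s + 1) : ℝ) * (((s + t + 1 : ℕ) : ℝ) ^ (s + t + 1))⁻¹,
    by positivity, by positivity, fun r p hr hp hp1 => ?_⟩
  obtain ⟨h1, h2⟩ := interior_ratio_bounds s t hr hp (sub_pos.2 hp1) (by ring)
  rw [bbFactor_eq (by omega) hr hp hp1, mul_assoc, mul_assoc,
    show s + 1 + (t + 1) - (s + 1) = t + 1 by omega,
    show s + 1 + (t + 1) - 1 = s + t + 1 by omega]
  exact ⟨by gcongr, by gcongr⟩

theorem exists_bbFactor_extreme_bounds {n y : ℕ} (hn : 1 ≤ n) (hy : y = 0 ∨ y = n) :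
    ∃ c c' : ℝ, 0 < c ∧ 0 < c' ∧ ∀ r p : ℝ, 0 < r → 0 < p → p < 1 →
      c' * (p ^ (n * if y = n then 1 else 0) * (1 - p) ^ (n * if y = 0 then 1 else 0)) ≤
          bbFactor n y r p ∧
        bbFactor n y r p ≤ c := by
  refine ⟨1, 1, one_pos, one_pos, fun r p hr hp hp1 => ?_⟩
  rcases hy with rfl | rfl
  · rw [bbFactor_eq (by omega) hr hp hp1]
    simpa [show 0 ≠ n by omega] using
      extreme_ratio_bounds n hr (sub_pos.2 hp1) (by linarith)
  · rw [bbFactor_eq le_rfl hr hp hp1]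
    simpa [show y ≠ 0 by omega] using extreme_ratio_bounds y hr hp hp1.le

/-- Likelihood bounds from the proof of Corollary 1: with at least one interior and at least
one extreme group, `L(r,β)` is bounded above by
`c r^{k_y} (∏_{j∈W_y} pⱼᴱ qⱼᴱ)/(1+r)^{k_y}` (interior groups only) and below by
`c' r^{k_y} (∏_{j∈W_y} pⱼᴱ qⱼᴱ)/(1+r)^{Σ_{W_y}(nⱼ-1)}` times
`∏_{j∉W_y} (pⱼᴱ)^{nⱼ 1{yⱼ=nⱼ}} (qⱼᴱ)^{nⱼ 1{yⱼ=0}}`. -/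
theorem likelihood_bounds_mixed (k m : ℕ) (x : Fin k → Fin m → ℝ) (n y : Fin k → ℕ)
    (hn : ∀ j, 1 ≤ n j) (hy : ∀ j, y j ≤ n j)
    (W : Finset (Fin k)) (hW : W = Finset.univ.filter fun j => 1 ≤ y j ∧ y j ≤ n j - 1)
    (hk1 : 1 ≤ W.card) (hk2 : W.card ≤ k - 1) :
    ∃ c c' : ℝ, 0 < c ∧ 0 < c' ∧
      ∀ r : ℝ, 0 < r → ∀ β : Fin m → ℝ,
        c' * (r ^ W.card * (∏ j ∈ W, pE x j β * (1 - pE x j β)) /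
                (1 + r) ^ (∑ j ∈ W, (n j - 1))) *
            (∏ j ∈ Wᶜ, pE x j β ^ (n j * if y j = n j then 1 else 0) *
              (1 - pE x j β) ^ (n j * if y j = 0 then 1 else 0))
          ≤ bbL x n y r β ∧
        bbL x n y r β
          ≤ c * (r ^ W.card * (∏ j ∈ W, pE x j β * (1 - pE x j β)) / (1 + r) ^ W.card) := by
  have hmem : ∀ j, j ∈ W ↔ 1 ≤ y j ∧ y j ≤ n j - 1 := fun j => by simp [hW]
  have hex : ∀ j, ∃ c c' : ℝ, 0 < c ∧ 0 < c' ∧ ∀ r p : ℝ, 0 < r → 0 < p → p < 1 →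
      c' * (if j ∈ W then r * (p * (1 - p)) / (1 + r) ^ (n j - 1) else
        p ^ (n j * if y j = n j then 1 else 0) * (1 - p) ^ (n j * if y j = 0 then 1 else 0)) ≤
          bbFactor (n j) (y j) r p ∧
        bbFactor (n j) (y j) r p ≤
          c * (if j ∈ W then r * (p * (1 - p)) / (1 + r) else 1) := by
    intro j
    by_cases hj : j ∈ W
    · simpa only [hj, if_true] using
        exists_bbFactor_interior_bounds ((hmem j).1 hj).1 ((hmem j).1 hj).2
    · simp only [hj, if_false, mul_one]
      refine exists_bbFactor_extreme_bounds (hn j) ?_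
      rw [hmem] at hj
      have := hn j
      have := hy j
      omega
  choose c c' hc hc' hb using hex
  refine ⟨∏ j, c j, ∏ j, c' j, prod_pos fun j _ => hc j, prod_pos fun j _ => hc' j,
    fun r hr β => ?_⟩
  have hp : ∀ j, 0 < pE x j β := fun j => logistic_pos _
  have hp1 : ∀ j, pE x j β < 1 := fun j => logistic_lt_one _
  have hq : ∀ j, 0 < 1 - pE x j β := fun j => sub_pos.2 (hp1 j)
  have hL : bbL x n y r β = ∏ j, bbFactor (n j) (y j) r (pE x j β) := rfl
  have hlow_nonneg : ∀ j, 0 ≤ c' j * (if j ∈ W then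
      r * (pE x j β * (1 - pE x j β)) / (1 + r) ^ (n j - 1) else
      pE x j β ^ (n j * if y j = n j then 1 else 0) *
        (1 - pE x j β) ^ (n j * if y j = 0 then 1 else 0)) := by
    intro j
    have := hc' j
    have := hp j
    have := hq j
    split_ifs <;> positivity
  have hW_prod : ∀ f g : Fin k → ℝ,
      ∏ j, (if j ∈ W then f j else g j) = (∏ j ∈ W, f j) * ∏ j ∈ Wᶜ, g j := by
    intro f g
    rw [← prod_mul_prod_compl W]
    congr 1
    · exact prod_congr rfl fun j hj => if_pos hj
    · exact prod_congr rfl fun j hj => if_neg (mem_compl.1 hj)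
  rw [hL]
  constructor
  · refine Eq.trans_le ?_ (prod_le_prod (fun j _ => hlow_nonneg j)
      fun j _ => (hb j r _ hr (hp j) (hp1 j)).1)
    symm
    rw [prod_mul_distrib, hW_prod, prod_div_distrib, prod_mul_distrib (f := fun _ => r),
      prod_const, prod_pow_eq_pow_sum, ← mul_assoc]
  · refine (prod_le_prod
      (fun j _ => (hlow_nonneg j).trans (hb j r _ hr (hp j) (hp1 j)).1)
      fun j _ => (hb j r _ hr (hp j) (hp1 j)).2).trans_eq ?_
    rw [prod_mul_distrib, hW_prod, prod_div_distrib, prod_mul_distrib (f := fun _ => r),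
      prod_const, prod_const, prod_const_one, mul_one]
end
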